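/- Let ρ ∈ ℂ with |ρ| < 1, x ∈ (0,∞), and a, b, c, d ∈ ℂ with positive real parts (non-real parameters occurring in conjugate pairs). Then ₂F₁(a+ix, c+ix; a+c; ρ) · ₂F₁(b−ix, d−ix; b+d; ρ) = Σ_{n=0}^∞ W_n(x²; a,b,c,d) ρⁿ / ((a+c)_n (b+d)_n n!), with the series converging absolutely. -/

import Mathlib

open Complex Finset

/-- The Pochhammer symbol (rising factorial) `(z)_n = z(z+1)⋯(z+n-1)`. -/
noncomputable def poch (z : ℂ) (n : ℕ) : ℂ := ∏ i ∈ Finset.range n, (z + i)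

/-- The Wilson polynomial `W_n(x²; a, b, c, d)` via its terminating `₄F₃`
representation. -/
noncomputable def wilson (n : ℕ) (x : ℝ) (a b c d : ℂ) : ℂ :=
  poch (a + b) n * poch (a + c) n * poch (a + d) n *
    ∑ j ∈ Finset.range (n + 1),
      poch (-(n : ℂ)) j * poch ((n : ℂ) + a + b + c + d - 1) j *
          poch (a + Complex.I * x) j * poch (a - Complex.I * x) j /
        (poch (a + b) j * poch (a + c) j * poch (a + d) j * j.factorial)

/-- The Gauss hypergeometric series `₂F₁(a, b; c; z)` as a formal sum. -/
noncomputable def F21 (a b c z : ℂ) : ℂ :=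
  ∑' n : ℕ, poch a n * poch b n / (poch c n * n.factorial) * z ^ n

lemma poch_zero (z : ℂ) : poch z 0 = 1 := by simp [poch]

lemma poch_succ (z : ℂ) (n : ℕ) : poch z (n + 1) = poch z n * (z + n) := by
  simp [poch, Finset.prod_range_succ]

lemma poch_add (z : ℂ) (m n : ℕ) : poch z (m + n) = poch z m * poch (z + m) n := by
  simp [poch, Finset.prod_range_add, add_assoc]

lemma poch_succ_left (z : ℂ) (n : ℕ) : poch z (n + 1) = z * poch (z + 1) n := by
  rw [add_comm n 1, poch_add]
  simp [poch]

lemma poch_eq_eval_ascPochhammer (z : ℂ) (n : ℕ) : poch z n = (ascPochhammer ℂ n).eval z := by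
  induction n with
  | zero => simp [poch]
  | succ n ih => rw [poch_succ, ascPochhammer_succ_eval, ih]

lemma add_natCast_ne_zero_of_re_pos {z : ℂ} (hz : 0 < z.re) (n : ℕ) : z + n ≠ 0 := by
  intro h
  have h' := congrArg Complex.re h
  simp only [Complex.add_re, Complex.natCast_re, Complex.zero_re] at h'
  have : (0 : ℝ) ≤ n := n.cast_nonneg
  linarith

lemma poch_ne_zero_of_re_pos {z : ℂ} (hz : 0 < z.re) (n : ℕ) : poch z n ≠ 0 :=
  Finset.prod_ne_zero_iff.mpr fun i _ => add_natCast_ne_zero_of_re_pos hz i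

/-- Reflection of the Pochhammer symbol: `(1 - n - z)_n = (-1)^n (z)_n`. -/
lemma poch_reflect (z : ℂ) (n : ℕ) : poch (1 - n - z) n = (-1) ^ n * poch z n := by
  induction n with
  | zero => simp [poch]
  | succ n ih =>
    rw [poch_succ_left, poch_succ, show (1 - ((n + 1 : ℕ) : ℂ) - z) + 1 = 1 - n - z by
      push_cast; ring, ih]
    push_cast
    ring

lemma poch_neg_natCast (n j : ℕ) :
    poch (-(n : ℂ)) j = (-1) ^ j * (j.factorial * n.choose j) := by
  induction j with
  | zero => simp [poch]
  | succ j ih =>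
    rw [poch_succ, ih, Nat.factorial_succ]
    have h : (n.choose (j + 1) : ℂ) * (j + 1) = n.choose j * (n - j) := by
      rcases le_or_gt j n with hj | hj
      · have := Nat.choose_succ_right_eq n j
        rw [← Nat.cast_sub hj]
        exact_mod_cast this
      · simp [Nat.choose_eq_zero_of_lt hj, Nat.choose_eq_zero_of_lt (Nat.lt_succ_of_lt hj)]
    push_cast
    linear_combination (-1) ^ j * (j.factorial : ℂ) * h

/-- The Pfaff–Saalschütz summation, cleared of denominators. -/
lemma pfaff_saalschutz (p q r : ℂ) (n : ℕ) :
    ∑ k ∈ Finset.range (n + 1), (n.choose k : ℂ) *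
      (poch p k * poch q k * poch (r - p - q) (n - k) * poch (r + k) (n - k)) =
      poch (r - p) n * poch (r - q) n := by
  induction n with
  | zero => simp [poch]
  | succ n ih =>
    rw [poch_succ (r - p), poch_succ (r - q)]
    have hsplit := Finset.sum_choose_succ_mul
      (fun k m => poch p k * poch q k * poch (r - p - q) m * poch (r + k) m) n
    rw [hsplit, ← sub_eq_zero]
    have htel := Finset.sum_range_sub (fun k : ℕ => (k : ℂ) * n.choose k *
      (poch p k * poch q k * poch (r - p - q) (n + 1 - k) * poch (r + k) (n - k))) (n + 1)
    simp only [Nat.choose_succ_self, Nat.cast_zero, mul_zero, zero_mul, sub_zero] at htel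
    rw [← htel, show poch (r - p) n * (r - p + n) * (poch (r - q) n * (r - q + n)) =
      (r - p + n) * (r - q + n) * (poch (r - p) n * poch (r - q) n) by ring, ← ih,
      Finset.mul_sum, ← Finset.sum_add_distrib, ← Finset.sum_sub_distrib]
    refine Finset.sum_congr rfl fun k hk => ?_
    obtain ⟨m, rfl⟩ := Nat.exists_eq_add_of_le (Nat.lt_succ_iff.mp (Finset.mem_range.mp hk))
    have hc : (((k + 1 : ℕ) : ℂ)) * (k + m).choose (k + 1) = (k + m).choose k * m := by
      have := Nat.choose_succ_right_eq (k + m) k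
      rw [Nat.add_sub_cancel_left, mul_comm] at this
      exact_mod_cast this
    rw [hc, show k + m + 1 - k = m + 1 by omega, show k + m - k = m by omega,
      show k + m + 1 - (k + 1) = m by omega]
    cases m with
    | zero =>
      simp [poch_succ, poch_zero]
      ring
    | succ m =>
      rw [show k + (m + 1) - (k + 1) = m by omega, poch_succ p, poch_succ q,
        poch_succ_left (r + k) (m + 1), poch_succ_left (r + k) m, poch_succ (r + k + 1) m,
        poch_succ (r - p - q) (m + 1),
        show r + ((k + 1 : ℕ) : ℂ) = r + k + 1 by push_cast; ring, poch_succ (r + k + 1) m]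
      push_cast
      ring

/-- The Pfaff–Saalschütz summation with the terms reflected. -/
lemma pfaff_saalschutz_reflected (p s t : ℂ) (n : ℕ) :
    ∑ m ∈ Finset.range (n + 1), (-1) ^ m * (n.choose m : ℂ) *
      (poch p m * poch (s + t - p + n - 1) m * poch (s + m) (n - m) * poch (t + m) (n - m)) =
      poch (s - p) n * poch (t - p) n := by
  have h := pfaff_saalschutz p (s + t - p + n - 1) s n
  rw [show s - (s + t - p + n - 1) = 1 - n - (t - p) by ring, poch_reflect] at h
  have hsq : ((-1 : ℂ) ^ n) * (-1) ^ n = 1 := by rw [← mul_pow]; simp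
  have h' : (-1) ^ n * (poch (s - p) n * ((-1) ^ n * poch (t - p) n)) =
      poch (s - p) n * poch (t - p) n := by linear_combination poch (s - p) n * poch (t - p) n * hsq
  rw [← h', ← h, Finset.mul_sum]
  refine Finset.sum_congr rfl fun m hm => ?_
  obtain ⟨l, rfl⟩ := Nat.exists_eq_add_of_le (Nat.lt_succ_iff.mp (Finset.mem_range.mp hm))
  have hl : poch (s - p - (s + t - p + ((m + l : ℕ) : ℂ) - 1)) l =
      (-1) ^ l * poch (t + m) l := by
    rw [← poch_reflect]
    congr 1
    push_cast
    ring
  have hl2 : ((-1 : ℂ) ^ l) * (-1) ^ l = 1 := by rw [← mul_pow]; simp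
  rw [Nat.add_sub_cancel_left, hl, pow_add]
  linear_combination -((-1) ^ m * ((m + l).choose m : ℂ) * (poch p m *
    poch (s + t - p + ((m + l : ℕ) : ℂ) - 1) m * poch (s + m) l * poch (t + m) l)) * hl2

/-- Coefficientwise form of the generating function: a Whipple transformation of the
terminating `₄F₃`, with `I * x` replaced by an arbitrary `e`. -/
lemma whipple_transformation (n : ℕ) {a b c d : ℂ} (e : ℂ)
    (hab : ∀ j, poch (a + b) j ≠ 0) (hac : ∀ j, poch (a + c) j ≠ 0)
    (had : ∀ j, poch (a + d) j ≠ 0) :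
    poch (a + b) n * poch (a + d) n *
      ∑ j ∈ Finset.range (n + 1),
        poch (-(n : ℂ)) j * poch ((n : ℂ) + a + b + c + d - 1) j *
            poch (a + e) j * poch (a - e) j /
          (poch (a + b) j * poch (a + c) j * poch (a + d) j * j.factorial) =
      ∑ k ∈ Finset.range (n + 1), (n.choose k : ℂ) *
        (poch (a + e) k * poch (c + e) k / poch (a + c) k *
          (poch (b - e) (n - k) * poch (d - e) (n - k) * poch (b + d + (n - k : ℕ)) k)) := by
  let G : ℕ → ℕ → ℂ := fun k m =>
    (-1) ^ (k + m) * (n.choose (k + m) : ℂ) * ((k + m).choose k : ℂ) * poch (a + e) (k + m) *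
      poch (a + b + (k + m : ℕ)) (n - (k + m)) * poch (a + d + (k + m : ℕ)) (n - (k + m)) *
      (poch (c + e) k * poch (1 - n - (b + d)) k * poch (a + b + d - e + n - 1) m /
        poch (a + c) k)
  have hterm : ∀ j ∈ Finset.range (n + 1), poch (a + b) n * poch (a + d) n *
      (poch (-(n : ℂ)) j * poch ((n : ℂ) + a + b + c + d - 1) j *
            poch (a + e) j * poch (a - e) j /
          (poch (a + b) j * poch (a + c) j * poch (a + d) j * j.factorial)) =
      ∑ k ∈ Finset.range (j + 1), G k (j - k) := by
    intro j hj
    have hjn : j ≤ n := Nat.lt_succ_iff.mp (Finset.mem_range.mp hj)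
    have h := pfaff_saalschutz (c + e) (1 - n - (b + d)) (a + c) j
    rw [show a + c - (c + e) = a - e by ring,
      show a + c - (1 - n - (b + d)) = n + a + b + c + d - 1 by ring,
      show a - e - (1 - n - (b + d)) = a + b + d - e + n - 1 by ring] at h
    have hb' : poch (a + b) n = poch (a + b) j * poch (a + b + j) (n - j) := by
      rw [← poch_add, Nat.add_sub_cancel' hjn]
    have hd' : poch (a + d) n = poch (a + d) j * poch (a + d + j) (n - j) := by
      rw [← poch_add, Nat.add_sub_cancel' hjn]
    have hfac : (j.factorial : ℂ) ≠ 0 := by exact_mod_cast j.factorial_ne_zero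
    have hL : poch (a + b) n * poch (a + d) n *
        (poch (-(n : ℂ)) j * poch ((n : ℂ) + a + b + c + d - 1) j *
            poch (a + e) j * poch (a - e) j /
          (poch (a + b) j * poch (a + c) j * poch (a + d) j * j.factorial)) =
        (-1) ^ j * (n.choose j : ℂ) * poch (a + e) j * poch (a + b + j) (n - j) *
          poch (a + d + j) (n - j) / poch (a + c) j *
          (poch (a - e) j * poch (n + a + b + c + d - 1) j) := by
      rw [hb', hd', poch_neg_natCast]
      have h1 := hab j
      have h2 := hac j
      have h3 := had j
      field_simp
    rw [hL, ← h, Finset.mul_sum]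
    refine Finset.sum_congr rfl fun k hk => ?_
    obtain ⟨m, rfl⟩ := Nat.exists_eq_add_of_le (Nat.lt_succ_iff.mp (Finset.mem_range.mp hk))
    have h1 := hac (k + m)
    have h2 := hac k
    have hcs : poch (a + c) (k + m) = poch (a + c) k * poch (a + c + k) m := poch_add _ _ _
    simp only [G, Nat.add_sub_cancel_left]
    rw [div_mul_eq_mul_div, mul_div_assoc', div_eq_div_iff h1 h2, hcs]
    ring
  rw [Finset.mul_sum, Finset.sum_congr rfl hterm, Finset.sum_range_diag_flip (n + 1) G]
  refine Finset.sum_congr rfl fun k hk => ?_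
  obtain ⟨N, rfl⟩ := Nat.exists_eq_add_of_le (Nat.lt_succ_iff.mp (Finset.mem_range.mp hk))
  rw [show k + N + 1 - k = N + 1 by omega, Nat.add_sub_cancel_left]
  have h := pfaff_saalschutz_reflected (a + e + k) (a + b + k) (a + d + k) N
  rw [show a + b + k - (a + e + k) = b - e by ring,
    show a + d + k - (a + e + k) = d - e by ring] at h
  have hq : poch (1 - ((k + N : ℕ) : ℂ) - (b + d)) k = (-1) ^ k * poch (b + d + N) k := by
    rw [← poch_reflect]
    congr 1
    push_cast
    ring
  have hk2 : ((-1 : ℂ) ^ k) * (-1) ^ k = 1 := by rw [← mul_pow]; simp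
  rw [← h, Finset.sum_mul, Finset.mul_sum, Finset.mul_sum]
  refine Finset.sum_congr rfl fun m hm => ?_
  simp only [G]
  have hmN : m ≤ N := Nat.lt_succ_iff.mp (Finset.mem_range.mp hm)
  have hch : ((k + N).choose (k + m) : ℂ) * ((k + m).choose k : ℂ) =
      ((k + N).choose k : ℂ) * (N.choose m : ℂ) := by
    have := Nat.choose_mul (n := k + N) (k := k + m) (s := k) (by omega)
    simp only [Nat.add_sub_cancel_left] at this
    exact_mod_cast this
  rw [hq, poch_add (a + e) k m, show k + N - (k + m) = N - m by omega,
    show a + b + ((k + m : ℕ) : ℂ) = a + b + k + m by push_cast; ring,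
    show a + d + ((k + m : ℕ) : ℂ) = a + d + k + m by push_cast; ring,
    show a + b + d - e + ((k + N : ℕ) : ℂ) - 1 =
      a + b + k + (a + d + k) - (a + e + k) + N - 1 by push_cast; ring, pow_add]
  let R := (-1) ^ m * poch (a + e) k * poch (a + e + k) m * poch (a + b + k + m) (N - m) *
    poch (a + d + k + m) (N - m) * (poch (c + e) k * poch (b + d + N) k *
      poch (a + b + k + (a + d + k) - (a + e + k) + N - 1) m / poch (a + c) k)
  linear_combination R * hch + ((k + N).choose (k + m) : ℂ) * ((k + m).choose k : ℂ) * R * hk2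

lemma wilson_coeff_eq_sum_antidiagonal (n : ℕ) (x : ℝ) {a b c d : ℂ} (ρ : ℂ)
    (hab : ∀ j, poch (a + b) j ≠ 0) (hac : ∀ j, poch (a + c) j ≠ 0)
    (had : ∀ j, poch (a + d) j ≠ 0) (hbd : ∀ j, poch (b + d) j ≠ 0) :
    wilson n x a b c d * ρ ^ n / (poch (a + c) n * poch (b + d) n * n.factorial) =
      ∑ kl ∈ Finset.HasAntidiagonal.antidiagonal n,
        (poch (a + Complex.I * x) kl.1 * poch (c + Complex.I * x) kl.1 /
            (poch (a + c) kl.1 * kl.1.factorial) * ρ ^ kl.1) *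
          (poch (b - Complex.I * x) kl.2 * poch (d - Complex.I * x) kl.2 /
            (poch (b + d) kl.2 * kl.2.factorial) * ρ ^ kl.2) := by
  have hW : wilson n x a b c d * ρ ^ n / (poch (a + c) n * poch (b + d) n * n.factorial) =
      ρ ^ n / (poch (b + d) n * n.factorial) * (poch (a + b) n * poch (a + d) n *
        ∑ j ∈ Finset.range (n + 1),
          poch (-(n : ℂ)) j * poch ((n : ℂ) + a + b + c + d - 1) j *
              poch (a + Complex.I * x) j * poch (a - Complex.I * x) j /
            (poch (a + b) j * poch (a + c) j * poch (a + d) j * j.factorial)) := by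
    have h1 := hac n
    have h2 := hbd n
    have h3 : (n.factorial : ℂ) ≠ 0 := by exact_mod_cast n.factorial_ne_zero
    rw [wilson]
    generalize (∑ j ∈ Finset.range (n + 1), (_ : ℂ)) = S
    field_simp
  rw [hW, whipple_transformation n _ hab hac had, Finset.mul_sum,
    Finset.Nat.sum_antidiagonal_eq_sum_range_succ_mk]
  refine Finset.sum_congr rfl fun k hk => ?_
  obtain ⟨l, rfl⟩ := Nat.exists_eq_add_of_le (Nat.lt_succ_iff.mp (Finset.mem_range.mp hk))
  have hch : ((k + l).choose k : ℂ) * k.factorial * l.factorial = (k + l).factorial := by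
    rw [Nat.choose_symm_add]
    exact_mod_cast Nat.add_choose_mul_factorial_mul_factorial k l
  have hp : poch (b + d) (k + l) = poch (b + d) l * poch (b + d + l) k := by
    rw [add_comm k l, poch_add]
  have h0 := hbd (k + l)
  rw [hp] at h0
  have h1 := hac k
  have h2 := hbd l
  have h3 : poch (b + d + l) k ≠ 0 := right_ne_zero_of_mul h0
  have h4 : (k.factorial : ℂ) ≠ 0 := by exact_mod_cast k.factorial_ne_zero
  have h5 : (l.factorial : ℂ) ≠ 0 := by exact_mod_cast l.factorial_ne_zero
  have h6 : ((k + l).choose k : ℂ) ≠ 0 := by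
    exact_mod_cast (Nat.choose_pos (Nat.le_add_right k l)).ne'
  simp only [Nat.add_sub_cancel_left]
  rw [← hch, hp, pow_add]
  field_simp

lemma summable_norm_F21 {a b c z : ℂ} (ha : 0 < a.re) (hb : 0 < b.re) (hc : 0 < c.re)
    (hz : ‖z‖ < 1) :
    Summable fun n : ℕ => ‖poch a n * poch b n / (poch c n * n.factorial) * z ^ n‖ := by
  have hne : ∀ {w : ℂ}, 0 < w.re → ∀ k : ℕ, (k : ℂ) ≠ -w := fun {w} hw k h =>
    add_natCast_ne_zero_of_re_pos hw k (by rw [h]; ring)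
  have hr : (ordinaryHypergeometricSeries ℂ a b c).radius = 1 :=
    ordinaryHypergeometricSeries_radius_eq_one ℂ a b c
      (fun k => ⟨hne ha k, hne hb k, hne hc k⟩)
  have hs := (ordinaryHypergeometricSeries ℂ a b c).summable_norm_apply (x := z) (by
    rw [hr]
    simpa [Metric.mem_eball, edist_zero_right, enorm_eq_nnnorm, ← NNReal.coe_lt_coe] using hz)
  refine hs.congr fun n => ?_
  rw [ordinaryHypergeometricSeries_apply_eq, smul_eq_mul, poch_eq_eval_ascPochhammer,
    poch_eq_eval_ascPochhammer, poch_eq_eval_ascPochhammer]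
  congr 1
  rw [div_eq_mul_inv, mul_inv]
  ring

theorem wilson_generating_function (ρ : ℂ) (hρ : ‖ρ‖ < 1) (x : ℝ) (hx : 0 < x)
    (a b c d : ℂ) (ha : 0 < a.re) (hb : 0 < b.re) (hc : 0 < c.re) (hd : 0 < d.re)
    (hconj : ({a, b, c, d} : Multiset ℂ).map (starRingEnd ℂ) =
      ({a, b, c, d} : Multiset ℂ)) :
    Summable (fun n : ℕ => ‖wilson n x a b c d * ρ ^ n /
        (poch (a + c) n * poch (b + d) n * n.factorial)‖) ∧
      HasSum (fun n : ℕ => wilson n x a b c d * ρ ^ n /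
          (poch (a + c) n * poch (b + d) n * n.factorial))
        (F21 (a + Complex.I * x) (c + Complex.I * x) (a + c) ρ *
          F21 (b - Complex.I * x) (d - Complex.I * x) (b + d) ρ) := by
  have hadd : ∀ {u v : ℂ}, 0 < u.re → 0 < v.re → ∀ j, poch (u + v) j ≠ 0 := fun hu hv =>
    poch_ne_zero_of_re_pos (by rw [Complex.add_re]; exact add_pos hu hv)
  have h₁ := summable_norm_F21 (a := a + Complex.I * x) (b := c + Complex.I * x) (c := a + c)
    (z := ρ) (by simpa using ha) (by simpa using hc) (by simpa using add_pos ha hc) hρ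
  have h₂ := summable_norm_F21 (a := b - Complex.I * x) (b := d - Complex.I * x) (c := b + d)
    (z := ρ) (by simpa using hb) (by simpa using hd) (by simpa using add_pos hb hd) hρ
  simp only [fun n => wilson_coeff_eq_sum_antidiagonal n x ρ (hadd ha hb) (hadd ha hc)
    (hadd ha hd) (hadd hb hd)]
  have hs := summable_norm_sum_mul_antidiagonal_of_summable_norm h₁ h₂
  refine ⟨hs, ?_⟩
  rw [F21, F21, tsum_mul_tsum_eq_tsum_sum_antidiagonal_of_summable_norm h₁ h₂]
  exact hs.of_norm.hasSum
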